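/- A coin system $ = ⟨1, c₂, c₃, c₄⟩ with four types of coins is non-canonical if and only if exactly one of the following holds: (1) the subsystem ⟨1, c₂, c₃⟩ is non-canonical; (2) ⟨1, c₂, c₃⟩ is canonical and there exists a natural number k with k·c₃ < c₄ < (k+1)·c₃ such that |GRD_$((k+1)·c₃)| > k + 1, where GRD_$ denotes the greedy representation under $. -/

import Mathlib

/-- A coin system `⟨c 1, c 2, …, c m⟩` is a strictly increasing finite sequence of
positive integers with `c 1 = 1` (only the values `c i` for `1 ≤ i ≤ m` matter). -/
def IsCoinSystem (m : ℕ) (c : ℕ → ℕ) : Prop :=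
  c 1 = 1 ∧ ∀ i j, 1 ≤ i → i < j → j ≤ m → c i < c j

/-- `α` is a representation of `x` under the coin system `⟨c 1, …, c m⟩`. -/
def IsRepr (m : ℕ) (c : ℕ → ℕ) (x : ℕ) (α : ℕ → ℕ) : Prop :=
  ∑ i ∈ Finset.Icc 1 m, α i * c i = x

/-- The size of a representation, i.e. the total number of coins used. -/
def reprSize (m : ℕ) (α : ℕ → ℕ) : ℕ :=
  ∑ i ∈ Finset.Icc 1 m, α i

/-- `α` is the greedy representation of `x`: a representation such that for every
`2 ≤ i ≤ m` the part of the sum using coins smaller than `c i` is `< c i`. -/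
def IsGreedy (m : ℕ) (c : ℕ → ℕ) (x : ℕ) (α : ℕ → ℕ) : Prop :=
  IsRepr m c x α ∧
    ∀ i, 2 ≤ i → i ≤ m → ∑ j ∈ Finset.Icc 1 (i - 1), α j * c j < c i

/-- `α` is an optimal (minimum-size) representation of `x`. -/
def IsOpt (m : ℕ) (c : ℕ → ℕ) (x : ℕ) (α : ℕ → ℕ) : Prop :=
  IsRepr m c x α ∧ ∀ β, IsRepr m c x β → reprSize m α ≤ reprSize m β

/-- `x` is a counterexample: the greedy representation of `x` is strictly larger
than some representation of `x` (equivalently, than an optimal one). -/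
def IsCounterexample (m : ℕ) (c : ℕ → ℕ) (x : ℕ) : Prop :=
  ∃ γ β, IsGreedy m c x γ ∧ IsRepr m c x β ∧ reprSize m β < reprSize m γ

/-- A coin system is non-canonical if it has a counterexample. -/
def NonCanonical (m : ℕ) (c : ℕ → ℕ) : Prop :=
  ∃ x, IsCounterexample m c x

/-- A coin system is canonical if `|GRD(x)| = |OPT(x)|` for all `x`,
i.e. it has no counterexample. -/
def IsCanonical (m : ℕ) (c : ℕ → ℕ) : Prop :=
  ∀ x, ¬ IsCounterexample m c x

/-- A coin system is tight if it has no counterexample smaller than its largest coin. -/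
def Tight (m : ℕ) (c : ℕ → ℕ) : Prop :=
  ∀ x, x < c m → ¬ IsCounterexample m c x

/-- `x` is the smallest counterexample of the coin system. -/
def SmallestCounterexample (m : ℕ) (c : ℕ → ℕ) (x : ℕ) : Prop :=
  IsCounterexample m c x ∧ ∀ y, y < x → ¬ IsCounterexample m c y

theorem isRepr_succ {n : ℕ} {c α : ℕ → ℕ} {x : ℕ} :
    IsRepr (n + 1) c x α ↔ ∃ y, IsRepr n c y α ∧ y + α (n + 1) * c (n + 1) = x := by
  simp [IsRepr, Finset.sum_Icc_succ_top]

theorem reprSize_succ (n : ℕ) (α : ℕ → ℕ) :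
    reprSize (n + 1) α = reprSize n α + α (n + 1) := by
  simp [reprSize, Finset.sum_Icc_succ_top]

theorem sum_update_succ (n : ℕ) (c α : ℕ → ℕ) (t : ℕ) {m : ℕ} (hm : m ≤ n) :
    ∑ i ∈ Finset.Icc 1 m, Function.update α (n + 1) t i * c i =
      ∑ i ∈ Finset.Icc 1 m, α i * c i := by
  refine Finset.sum_congr rfl fun i hi => ?_
  rw [Finset.mem_Icc] at hi
  rw [Function.update_of_ne (by omega)]

theorem reprSize_update_succ (n : ℕ) (α : ℕ → ℕ) (t : ℕ) :
    reprSize (n + 1) (Function.update α (n + 1) t) = reprSize n α + t := by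
  rw [reprSize_succ, Function.update_self]
  simpa [reprSize] using sum_update_succ n (fun _ => 1) α t le_rfl

theorem IsRepr.update_succ {n : ℕ} {c α : ℕ → ℕ} {x : ℕ} (h : IsRepr n c x α) (t : ℕ) :
    IsRepr (n + 1) c (x + t * c (n + 1)) (Function.update α (n + 1) t) :=
  isRepr_succ.2 ⟨x, (sum_update_succ n c α t le_rfl).trans h, by rw [Function.update_self]⟩

theorem IsRepr.add {n : ℕ} {c α β : ℕ → ℕ} {x y : ℕ} (hα : IsRepr n c x α)
    (hβ : IsRepr n c y β) : IsRepr n c (x + y) (α + β) := by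
  unfold IsRepr at *
  simp [add_mul, Finset.sum_add_distrib, hα, hβ]

theorem reprSize_add (n : ℕ) (α β : ℕ → ℕ) :
    reprSize n (α + β) = reprSize n α + reprSize n β := by
  simp [reprSize, Finset.sum_add_distrib]

theorem IsGreedy.update_succ {n : ℕ} {c α : ℕ → ℕ} {x : ℕ} (h : IsGreedy n c x α)
    (hx : x < c (n + 1)) (t : ℕ) :
    IsGreedy (n + 1) c (x + t * c (n + 1)) (Function.update α (n + 1) t) := by
  refine ⟨h.1.update_succ t, fun i hi hin => ?_⟩
  rw [sum_update_succ n c α t (by omega)]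
  rcases hin.lt_or_eq with hlt | rfl
  · exact h.2 i hi (by omega)
  · exact lt_of_eq_of_lt h.1 hx

theorem IsGreedy.of_succ {n : ℕ} {c α : ℕ → ℕ} {x : ℕ} (h : IsGreedy (n + 1) c x α) :
    ∃ y, IsGreedy n c y α ∧ y + α (n + 1) * c (n + 1) = x := by
  obtain ⟨y, hy, hyx⟩ := isRepr_succ.1 h.1
  exact ⟨y, ⟨hy, fun i hi hin => h.2 i hi (by omega)⟩, hyx⟩

theorem IsCoinSystem.of_succ {n : ℕ} {c : ℕ → ℕ} (hc : IsCoinSystem (n + 1) c) :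
    IsCoinSystem n c :=
  ⟨hc.1, fun i j hi hij hj => hc.2 i j hi hij (by omega)⟩

theorem IsCoinSystem.pos {n : ℕ} {c : ℕ → ℕ} (hc : IsCoinSystem n c) {i : ℕ} (hi : 1 ≤ i)
    (hin : i ≤ n) : 0 < c i := by
  rcases hi.lt_or_eq with h | rfl
  · exact (Nat.zero_le _).trans_lt (hc.2 1 i le_rfl h hin)
  · simp [hc.1]

theorem IsCoinSystem.exists_isGreedy {n : ℕ} {c : ℕ → ℕ} (hc : IsCoinSystem (n + 1) c) (x : ℕ) :
    ∃ γ, IsGreedy (n + 1) c x γ := by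
  induction n generalizing x with
  | zero => exact ⟨fun _ => x, by simp [IsRepr, hc.1], fun i hi hin => by omega⟩
  | succ n ih =>
    have hpos : 0 < c (n + 2) := hc.pos (by omega) le_rfl
    obtain ⟨γ, hγ⟩ := ih hc.of_succ (x % c (n + 2))
    have h := hγ.update_succ (Nat.mod_lt _ hpos) (x / c (n + 2))
    rw [mul_comm, Nat.mod_add_div] at h
    exact ⟨_, h⟩

/-- In a greedy representation the coins below the largest one sum to less than it. -/
theorem IsGreedy.lower_lt {n : ℕ} {c α : ℕ → ℕ} {x y : ℕ} (hc : IsCoinSystem (n + 1) c)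
    (h : IsGreedy (n + 1) c x α) (hy : IsRepr n c y α) : y < c (n + 1) := by
  rcases Nat.eq_zero_or_pos n with rfl | hn
  · have : y = 0 := by simpa [IsRepr, eq_comm] using hy
    rw [this]
    exact hc.pos le_rfl le_rfl
  · exact lt_of_eq_of_lt hy.symm (h.2 (n + 1) (by omega) le_rfl)

theorem IsCanonical.reprSize_le {n : ℕ} {c γ β : ℕ → ℕ} {x : ℕ} (h : IsCanonical n c)
    (hγ : IsGreedy n c x γ) (hβ : IsRepr n c x β) : reprSize n γ ≤ reprSize n β :=
  not_lt.1 fun hlt => h x ⟨γ, β, hγ, hβ, hlt⟩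

/-- In a canonical system, any representation of an amount containing the largest coin can be
improved to one using the largest coin, which can then be removed. -/
theorem IsCanonical.exists_remove {n : ℕ} {c : ℕ → ℕ} (hc : IsCoinSystem (n + 1) c)
    (hcan : IsCanonical (n + 1) c) {x : ℕ} {β : ℕ → ℕ}
    (hβ : IsRepr (n + 1) c (x + c (n + 1)) β) :
    ∃ α, IsRepr (n + 1) c x α ∧ reprSize (n + 1) α < reprSize (n + 1) β := by
  obtain ⟨γ, hγ⟩ := hc.exists_isGreedy (x + c (n + 1))
  obtain ⟨y, hy, hyx⟩ := isRepr_succ.1 hγ.1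
  have hlt := hγ.lower_lt hc hy
  have hle := hcan.reprSize_le hγ hβ
  rw [reprSize_succ] at hle
  obtain ⟨t, ht⟩ : ∃ t, γ (n + 1) = t + 1 := by
    refine Nat.exists_eq_succ_of_ne_zero fun h0 => ?_
    rw [h0] at hyx
    omega
  refine ⟨Function.update γ (n + 1) t, ?_, ?_⟩
  · have h := hy.update_succ t
    have hx : y + t * c (n + 1) = x := by
      rw [ht] at hyx
      linarith
    rwa [hx] at h
  · rw [reprSize_update_succ]
    omega

/-- The one-point theorem: a canonical system stays canonical after adding a new largest coin `d`
with `k * b < d ≤ (k + 1) * b`, where `b` is the old largest coin, as soon as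
`(k + 1) * b - d` is representable with at most `k` old coins. -/
theorem IsCanonical.succ {n : ℕ} {c : ℕ → ℕ} (hc : IsCoinSystem (n + 2) c)
    (hcan : IsCanonical (n + 1) c) {k r : ℕ} {ρ : ℕ → ℕ} (hk : k * c (n + 1) < c (n + 2))
    (hr : c (n + 2) + r = (k + 1) * c (n + 1)) (hρ : IsRepr (n + 1) c r ρ)
    (hρk : reprSize (n + 1) ρ ≤ k) : IsCanonical (n + 2) c := by
  have step : ∀ x β, IsRepr (n + 1) c (x + c (n + 2)) β →
      ∃ α, IsRepr (n + 1) c x α ∧ reprSize (n + 1) α < reprSize (n + 1) β := by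
    intro x β hβ
    obtain ⟨γ, hγ⟩ := hc.of_succ.exists_isGreedy (x + c (n + 2))
    obtain ⟨y, hy, hyx⟩ := isRepr_succ.1 hγ.1
    have hlt := hγ.lower_lt hc.of_succ hy
    have hle := hcan.reprSize_le hγ hβ
    rw [reprSize_succ] at hle
    obtain ⟨t, ht⟩ : ∃ t, γ (n + 1) = k + t := by
      refine Nat.exists_eq_add_of_le (not_lt.1 fun hlt' => ?_)
      have := Nat.mul_le_mul_right (c (n + 1)) (Nat.succ_le_of_lt hlt')
      rw [Nat.succ_mul] at this
      omega
    have hx : y + t * c (n + 1) + r = x + c (n + 1) := by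
      rw [ht] at hyx
      linarith
    have h := (hy.update_succ t).add hρ
    rw [hx] at h
    obtain ⟨α, hα, hlt'⟩ := hcan.exists_remove hc.of_succ h
    rw [reprSize_add, reprSize_update_succ] at hlt'
    exact ⟨α, hα, by omega⟩
  have steps : ∀ q x β, IsRepr (n + 1) c (x + q * c (n + 2)) β →
      ∃ α, IsRepr (n + 1) c x α ∧ reprSize (n + 1) α + q ≤ reprSize (n + 1) β := by
    intro q
    induction q with
    | zero => exact fun x β hβ => ⟨β, by simpa using hβ, le_rfl⟩
    | succ q ih =>
      intro x β hβ
      rw [Nat.succ_mul, ← add_assoc] at hβ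
      obtain ⟨α, hα, hαβ⟩ := step _ _ hβ
      obtain ⟨α', hα', hle⟩ := ih _ _ hα
      exact ⟨α', hα', by omega⟩
  rintro x ⟨γ, β, hγ, hβ, hlt⟩
  obtain ⟨y, hy, hyx⟩ := hγ.of_succ
  obtain ⟨z, hz, hzx⟩ := isRepr_succ.1 hβ
  have hyd := hγ.lower_lt hc hy.1
  rw [reprSize_succ (n + 1), reprSize_succ (n + 1)] at hlt
  obtain ⟨q, hq⟩ : ∃ q, γ (n + 2) = β (n + 2) + q := by
    refine Nat.exists_eq_add_of_le (not_lt.1 fun hlt' => ?_)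
    have := Nat.mul_le_mul_right (c (n + 2)) (Nat.succ_le_of_lt hlt')
    rw [Nat.succ_mul] at this
    simp only [add_assoc, Nat.reduceAdd] at hyx hzx hyd this
    omega
  have hzy : z = y + q * c (n + 2) := by
    simp only [add_assoc, Nat.reduceAdd] at hyx hzx
    rw [hq] at hyx
    linarith
  rw [hzy] at hz
  obtain ⟨α, hα, hle⟩ := steps q y β hz
  have := hcan.reprSize_le hy hα
  simp only [add_assoc, Nat.reduceAdd] at hlt
  omega

theorem isCanonical_one {c : ℕ → ℕ} (hc : c 1 = 1) : IsCanonical 1 c := by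
  rintro x ⟨γ, β, hγ, hβ, hlt⟩
  have hγ' := hγ.1
  simp only [IsRepr, reprSize, Finset.Icc_self, Finset.sum_singleton, hc, mul_one]
    at hγ' hβ hlt
  omega

theorem isRepr_zero (n : ℕ) (c : ℕ → ℕ) : IsRepr n c 0 0 := by simp [IsRepr]

theorem reprSize_zero (n : ℕ) : reprSize n 0 = 0 := by simp [reprSize]

theorem IsCoinSystem.isCanonical_two {c : ℕ → ℕ} (hc : IsCoinSystem 2 c) : IsCanonical 2 c := by
  have h2 : 0 < c 2 := hc.pos (by omega) le_rfl
  refine (isCanonical_one hc.1).succ hc (k := c 2 - 1) (r := 0) ?_ ?_ (isRepr_zero 1 c) ?_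
  · simp only [zero_add, hc.1]
    omega
  · simp only [zero_add, hc.1]
    omega
  · simp [reprSize_zero]

theorem Nat.exists_mul_lt_le_succ_mul {b d : ℕ} (hb : 0 < b) (hd : 0 < d) :
    ∃ k, k * b < d ∧ d ≤ (k + 1) * b := by
  refine ⟨(d - 1) / b, ?_, ?_⟩
  · have := Nat.div_mul_le_self (d - 1) b
    omega
  · have := Nat.lt_mul_div_succ (d - 1) hb
    rw [mul_comm] at this
    omega

/-- A non-canonical system `⟨1, a, b⟩` fails the one-point test at the least multiple of `a`
that is at least `b`. -/
theorem NonCanonical.exists_three {c : ℕ → ℕ} (hc : IsCoinSystem 3 c) (h : NonCanonical 3 c) :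
    ∃ k r, k * c 2 < c 3 ∧ c 3 + r = (k + 1) * c 2 ∧ k < r := by
  have h2 : 0 < c 2 := hc.pos (by omega) (by omega)
  have h3 : 0 < c 3 := hc.pos (by omega) (by omega)
  obtain ⟨k, hk, hk'⟩ := Nat.exists_mul_lt_le_succ_mul h2 h3
  obtain ⟨r, hr⟩ := Nat.exists_eq_add_of_le hk'
  refine ⟨k, r, hk, hr.symm, not_le.1 fun hle => ?_⟩
  obtain ⟨x, hx⟩ := h
  refine hc.of_succ.isCanonical_two.succ hc (ρ := fun i => if i = 1 then r else 0)
    hk hr.symm ?_ ?_ x hx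
  · simp [IsRepr, hc.1]
  · simpa [reprSize, Finset.sum_Icc_succ_top] using hle

theorem nonCanonical_four_of_lt {c : ℕ → ℕ} (hc : c 1 = 1) {x₁ x₂ x₃ x₄ y₁ y₂ y₃ y₄ : ℕ}
    (h₂ : x₁ < c 2) (h₃ : x₁ + x₂ * c 2 < c 3) (h₄ : x₁ + x₂ * c 2 + x₃ * c 3 < c 4)
    (heq : y₁ + y₂ * c 2 + y₃ * c 3 + y₄ * c 4 = x₁ + x₂ * c 2 + x₃ * c 3 + x₄ * c 4)
    (hlt : y₁ + y₂ + y₃ + y₄ < x₁ + x₂ + x₃ + x₄) : NonCanonical 4 c := by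
  refine ⟨x₁ + x₂ * c 2 + x₃ * c 3 + x₄ * c 4,
    fun i => if i = 1 then x₁ else if i = 2 then x₂ else if i = 3 then x₃ else x₄,
    fun i => if i = 1 then y₁ else if i = 2 then y₂ else if i = 3 then y₃ else y₄,
    ⟨?_, fun i hi hi4 => ?_⟩, ?_, ?_⟩
  · simp [IsRepr, Finset.sum_Icc_succ_top, hc]
  · interval_cases i
    · simpa [hc] using h₂
    · simpa [Finset.sum_Icc_succ_top, hc] using h₃
    · simpa [Finset.sum_Icc_succ_top, hc] using h₄
  · simpa [IsRepr, Finset.sum_Icc_succ_top, hc] using heq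
  · simpa [reprSize, Finset.sum_Icc_succ_top] using hlt

theorem NonCanonical.four_of_three {c : ℕ → ℕ} (hc : IsCoinSystem 4 c) (h : NonCanonical 3 c) :
    NonCanonical 4 c := by
  obtain ⟨k, r, hk, hr, hkr⟩ := h.exists_three hc.of_succ
  have h12 : c 1 < c 2 := hc.2 1 2 (by omega) (by omega) (by omega)
  have h23 : c 2 < c 3 := hc.2 2 3 (by omega) (by omega) (by omega)
  have h34 : c 3 < c 4 := hc.2 3 4 (by omega) (by omega) (by omega)
  have h1 := hc.1
  rw [Nat.succ_mul] at hr
  rcases lt_or_ge (c 3 + r) (c 4) with h4 | h4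
  · exact nonCanonical_four_of_lt h1 (x₁ := r) (x₂ := 0) (x₃ := 1) (x₄ := 0)
      (y₁ := 0) (y₂ := k + 1) (y₃ := 0) (y₄ := 0) (by omega) (by omega) (by omega)
      (by rw [Nat.succ_mul]; omega) (by omega)
  rcases le_or_gt (c 4 + 2) (c 2 + c 3) with h5 | h5
  · exact nonCanonical_four_of_lt h1 (x₁ := c 2 + c 3 - c 4) (x₂ := 0) (x₃ := 0) (x₄ := 1)
      (y₁ := 0) (y₂ := 1) (y₃ := 1) (y₄ := 0) (by omega) (by omega) (by omega)
      (by omega) (by omega)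
  obtain ⟨j, rfl⟩ : ∃ j, k = j + 1 := by
    refine Nat.exists_eq_succ_of_ne_zero fun h0 => ?_
    rw [h0] at hr
    omega
  rw [Nat.succ_mul] at hk hr
  exact nonCanonical_four_of_lt h1 (x₁ := 2) (x₂ := j) (x₃ := 0) (x₄ := 1)
    (y₁ := 0) (y₂ := 0) (y₃ := 2) (y₄ := 0) (by omega) (by omega) (by omega)
    (by omega) (by omega)

/-- A coin system `⟨1, c 2, c 3, c 4⟩` is non-canonical iff either `⟨1, c 2, c 3⟩` is
non-canonical, or `⟨1, c 2, c 3⟩` is canonical and `|GRD((k+1) * c 3)| > k + 1` for the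
`k` with `k * c 3 < c 4 < (k+1) * c 3`. -/
theorem stmt_6 (c : ℕ → ℕ) (hc : IsCoinSystem 4 c) :
    NonCanonical 4 c ↔
      (NonCanonical 3 c ∨
        (IsCanonical 3 c ∧ ∃ k : ℕ, k * c 3 < c 4 ∧ c 4 < (k + 1) * c 3 ∧
          ∃ γ, IsGreedy 4 c ((k + 1) * c 3) γ ∧ k + 1 < reprSize 4 γ)) := by
  constructor
  · rintro ⟨x, hx⟩
    by_cases h : NonCanonical 3 c
    · exact Or.inl h
    have hcan : IsCanonical 3 c := fun y hy => h ⟨y, hy⟩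
    have h3 : 0 < c 3 := hc.pos (by omega) (by omega)
    have h34 : c 3 < c 4 := hc.2 3 4 (by omega) (by omega) (by omega)
    obtain ⟨k, hk, hk'⟩ := Nat.exists_mul_lt_le_succ_mul h3 (h3.trans h34)
    obtain ⟨r, hr⟩ := Nat.exists_eq_add_of_le hk'
    obtain ⟨γ, hγ⟩ := hc.of_succ.exists_isGreedy r
    have hγk : k < reprSize 3 γ :=
      not_le.1 fun hle => hcan.succ hc hk hr.symm hγ.1 hle x hx
    have hr0 : c 4 < (k + 1) * c 3 := by
      refine hk'.lt_of_ne fun h0 => ?_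
      exact hcan.succ hc hk (r := 0) h0 (isRepr_zero 3 c) (by simp [reprSize_zero]) x hx
    have hr4 : r < c 4 := by
      rw [Nat.succ_mul] at hr
      omega
    have hg := hγ.update_succ hr4 1
    rw [show r + 1 * c (3 + 1) = (k + 1) * c 3 by rw [hr]; ring] at hg
    refine Or.inr ⟨hcan, k, hk, hr0, _, hg, ?_⟩
    rw [reprSize_update_succ]
    omega
  · rintro (h | ⟨-, k, -, -, γ, hγ, hlt⟩)
    · exact h.four_of_three hc
    · refine ⟨_, γ, fun i => if i = 3 then k + 1 else 0, hγ, ?_, ?_⟩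
      · simp [IsRepr]
      · simpa [reprSize, Finset.sum_Icc_succ_top] using hlt
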